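/- arXiv:2105.04335 — 4 statements merged into one kernel-verified Lean document; each statement's English description precedes it below -/
import Mathlib

section
/- Let K ⊆ ℝⁿ be a proper cone and A ∈ ℝ^{n×n} cross-positive over K. Let μ = max{Re(λ) : λ ∈ ℂ an eigenvalue of A}. Then: (1) μ is an eigenvalue of A; (2) there exist nonzero x ∈ K and nonzero y ∈ K* with Ax = μx and Aᵀy = μy. If in addition A is K-irreducible (no eigenvector of A lies on the boundary of K), then (3) μ is a simple eigenvalue of A (a simple root of the characteristic polynomial), and (4) the eigenvectors x and y can be chosen with x ∈ int K and y ∈ int K*. -/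
open Matrix

/-- A proper cone in `ℝⁿ`: a closed convex cone that is pointed and solid. -/
def IsProperCone {n : ℕ} (K : Set (Fin n → ℝ)) : Prop :=
  IsClosed K ∧
  (∀ x ∈ K, ∀ y ∈ K, x + y ∈ K) ∧
  (∀ a : ℝ, 0 ≤ a → ∀ x ∈ K, a • x ∈ K) ∧
  (∀ x, x ∈ K → -x ∈ K → x = 0) ∧
  (interior K).Nonempty

/-- The dual cone with respect to the standard inner product on `ℝⁿ`. -/
def dualCone {n : ℕ} (K : Set (Fin n → ℝ)) : Set (Fin n → ℝ) :=
  {y | ∀ x ∈ K, 0 ≤ y ⬝ᵥ x}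

/-- `A` is cross-positive over `K`: `⟨y, Ax⟩ ≥ 0` whenever `x ∈ K`, `y ∈ K*`
and `⟨y, x⟩ = 0`. -/
def CrossPositive {n : ℕ} (K : Set (Fin n → ℝ)) (A : Matrix (Fin n) (Fin n) ℝ) : Prop :=
  ∀ x ∈ K, ∀ y ∈ dualCone K, y ⬝ᵥ x = 0 → 0 ≤ y ⬝ᵥ A.mulVec x

/-- `μ` is an eigenvalue of the complex matrix `M` (with some nonzero eigenvector). -/
def HasEigen {n : ℕ} (M : Matrix (Fin n) (Fin n) ℂ) (μ : ℂ) : Prop :=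
  ∃ v : Fin n → ℂ, v ≠ 0 ∧ M.mulVec v = μ • v

lemma int_nudge {n : ℕ} {K : Set (Fin n → ℝ)} {x : Fin n → ℝ} (hx : x ∈ interior K)
    (v : Fin n → ℝ) : ∃ ε > 0, ∀ t : ℝ, |t| ≤ ε → x + t • v ∈ interior K := by
  have hc : Continuous (fun t : ℝ => x + t • v) := by fun_prop
  have h0 : (fun t : ℝ => x + t • v) ⁻¹' interior K ∈ nhds (0 : ℝ) :=
    hc.continuousAt.preimage_mem_nhds (by simpa using isOpen_interior.mem_nhds hx)
  obtain ⟨ε, hε, h⟩ := Metric.mem_nhds_iff.1 h0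
  refine ⟨ε / 2, by positivity, fun t ht => h ?_⟩
  simp only [Metric.mem_ball, dist_zero_right, Real.norm_eq_abs]
  linarith

lemma IsProperCone.convex {n : ℕ} {K : Set (Fin n → ℝ)} (hK : IsProperCone K) : Convex ℝ K :=
  fun _ hx _ hy _ _ ha hb _ => hK.2.1 _ (hK.2.2.1 _ ha _ hx) _ (hK.2.2.1 _ hb _ hy)

lemma IsProperCone.zero_mem {n : ℕ} {K : Set (Fin n → ℝ)} (hK : IsProperCone K) :
    (0 : Fin n → ℝ) ∈ K := by
  obtain ⟨x, hx⟩ := hK.2.2.2.2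
  simpa using hK.2.2.1 0 le_rfl x (interior_subset hx)

lemma dual_pos {n : ℕ} {K : Set (Fin n → ℝ)} {x y : Fin n → ℝ} (hx : x ∈ interior K)
    (hy : y ∈ dualCone K) (hy0 : y ≠ 0) : 0 < y ⬝ᵥ x := by
  obtain ⟨ε, hε, h⟩ := int_nudge hx y
  have h1 := hy _ (interior_subset (h (-ε) (by rw [abs_neg, abs_of_pos hε])))
  have h2 : 0 < y ⬝ᵥ y := by
    have h3 : 0 ≤ y ⬝ᵥ y := Finset.sum_nonneg fun i _ => mul_self_nonneg _
    rcases h3.lt_or_eq with h | h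
    · exact h
    · exact absurd (dotProduct_self_eq_zero.1 h.symm) hy0
  rw [dotProduct_add, dotProduct_smul, smul_eq_mul] at h1
  nlinarith [mul_pos hε h2]

lemma support {n : ℕ} {K : Set (Fin n → ℝ)} (hK : IsProperCone K) {p : Fin n → ℝ}
    (hp : p ∈ K) (hp' : p ∉ interior K) :
    ∃ y ∈ dualCone K, y ≠ 0 ∧ y ⬝ᵥ p = 0 := by
  obtain ⟨f, hf⟩ := geometric_hahn_banach_open_point hK.convex.interior isOpen_interior hp'
  have hle : ∀ a ∈ K, f a ≤ f p := by
    intro a ha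
    have h1 : a ∈ closure (interior K) := by
      rw [hK.convex.closure_interior_eq_closure_of_nonempty_interior hK.2.2.2.2]
      exact subset_closure ha
    have h2 : closure (interior K) ⊆ {a | f a ≤ f p} :=
      closure_minimal (fun a ha => (hf a ha).le) (isClosed_le f.continuous continuous_const)
    exact h2 h1
  have hp0 : 0 ≤ f p := by simpa using hle 0 hK.zero_mem
  have h2p : f p = 0 := by
    have := hle _ (hK.2.2.1 2 (by norm_num) p hp)
    rw [map_smul, smul_eq_mul] at this
    linarith
  obtain ⟨y, hy⟩ := (dotProductEquiv ℝ (Fin n)).surjective (-f.toLinearMap)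
  have hyf : ∀ a, y ⬝ᵥ a = - f a := by
    intro a
    rw [← dotProductEquiv_apply_apply, hy]; simp
  refine ⟨y, fun a ha => ?_, ?_, by rw [hyf, h2p, neg_zero]⟩
  · rw [hyf]; have := hle a ha; linarith
  · rintro rfl
    obtain ⟨e, he⟩ := hK.2.2.2.2
    have h1 := hf e he
    have h2 := hyf e
    rw [zero_dotProduct] at h2
    linarith

open scoped Pointwise in
/-- Largeness: some multiple of an interior point dominates. -/
lemma absorb {n : ℕ} {K : Set (Fin n → ℝ)} (hK : IsProperCone K) {x : Fin n → ℝ}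
    (hx : x ∈ interior K) (v : Fin n → ℝ) : ∃ c > (0 : ℝ), ∀ d : ℝ, d ≥ c → d • x + v ∈ interior K := by
  obtain ⟨ε, hε, h⟩ := int_nudge hx v
  refine ⟨1 / ε, by positivity, fun d hd => ?_⟩
  have hd0 : 0 < d := lt_of_lt_of_le (by positivity) hd
  have h1 := h (1 / d) (by
    rw [abs_of_pos (by positivity)]
    rw [ge_iff_le, div_le_iff₀ hε] at hd
    rw [div_le_iff₀ hd0]; linarith)
  have h2 : d • x + v = d • (x + (1 / d) • v) := by
    rw [smul_add, smul_smul, mul_one_div_cancel hd0.ne', one_smul]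
  rw [h2]
  have h3 : d • interior K ⊆ interior K := by
    rw [← interior_smul₀ hd0.ne']
    apply interior_mono
    rintro _ ⟨a, ha, rfl⟩
    exact hK.2.2.1 d hd0.le a ha
  exact h3 ⟨_, h1, rfl⟩

lemma hitting {n : ℕ} {K : Set (Fin n → ℝ)} (hK : IsProperCone K) {x z : Fin n → ℝ}
    (hx : x ∈ interior K) (hz : z ∉ K) :
    ∃ c > (0 : ℝ), ∃ y ∈ dualCone K, y ≠ 0 ∧ c • x + z ∈ K ∧ c • x + z ∉ interior K ∧
      y ⬝ᵥ (c • x + z) = 0 := by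
  obtain ⟨c1, hc1, h1⟩ := absorb hK hx z
  let T : Set ℝ := {c | 0 ≤ c ∧ c • x + z ∈ K}
  have hT : IsClosed T := by
    apply IsClosed.inter isClosed_Ici
    exact hK.1.preimage (f := fun c : ℝ => c • x + z) (by fun_prop)
  have hne : T.Nonempty := ⟨c1, hc1.le, interior_subset (h1 c1 le_rfl)⟩
  have hbb : BddBelow T := ⟨0, fun c hc => hc.1⟩
  obtain ⟨hc0, hcK⟩ := hT.csInf_mem hne hbb
  set c := sInf T
  have hcpos : 0 < c := by
    rcases hc0.lt_or_eq with h | h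
    · exact h
    · rw [← h] at hcK; simp at hcK; exact absurd hcK hz
  have hni : c • x + z ∉ interior K := by
    intro hi
    obtain ⟨ε, hε, h⟩ := int_nudge hi x
    have hm : 0 < min ε c := lt_min hε hcpos
    have h2 := h (-(min ε c)) (by rw [abs_neg, abs_of_pos hm]; exact min_le_left _ _)
    have h3 : c - min ε c ∈ T := by
      refine ⟨by linarith [min_le_right ε c], ?_⟩
      convert interior_subset h2 using 1
      module
    have := csInf_le hbb h3
    linarith
  obtain ⟨y, hy, hy0, hyp⟩ := support hK hcK hni
  exact ⟨c, hcpos, y, hy, hy0, hcK, hni, hyp⟩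

lemma bidual {n : ℕ} {K : Set (Fin n → ℝ)} (hK : IsProperCone K) :
    dualCone (dualCone K) = K := by
  ext z
  constructor
  · intro hz
    by_contra hzK
    obtain ⟨x, hx⟩ := hK.2.2.2.2
    obtain ⟨c, hc, y, hy, hy0, -, -, h⟩ := hitting hK hx hzK
    have h1 := hz y hy
    have h2 := dual_pos hx hy hy0
    rw [dotProduct_add, dotProduct_smul, smul_eq_mul, dotProduct_comm y z] at h
    nlinarith [mul_pos hc h2]
  · intro hz y hy
    rw [dotProduct_comm]; exact hy z hz

lemma solid_of_span {n : ℕ} {C : Set (Fin n → ℝ)} (hc : Convex ℝ C) (h0 : (0 : Fin n → ℝ) ∈ C)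
    (hs : Submodule.span ℝ C = ⊤) : (interior C).Nonempty := by
  rw [hc.interior_nonempty_iff_affineSpan_eq_top]
  have h1 := affineSpan_insert_zero (k := ℝ) C
  rw [Set.insert_eq_of_mem h0, hs] at h1
  apply SetLike.coe_injective
  rw [h1]; simp

lemma dual_proper {n : ℕ} {K : Set (Fin n → ℝ)} (hK : IsProperCone K) :
    IsProperCone (dualCone K) := by
  have hadd : ∀ x ∈ dualCone K, ∀ y ∈ dualCone K, x + y ∈ dualCone K := by
    intro x hx y hy a ha
    rw [add_dotProduct]; exact add_nonneg (hx a ha) (hy a ha)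
  have hsm : ∀ a : ℝ, 0 ≤ a → ∀ x ∈ dualCone K, a • x ∈ dualCone K := by
    intro a ha x hx b hb
    rw [smul_dotProduct, smul_eq_mul]; exact mul_nonneg ha (hx b hb)
  refine ⟨?_, hadd, hsm, ?_, ?_⟩
  · have : dualCone K = ⋂ x ∈ K, {y | 0 ≤ y ⬝ᵥ x} := by ext; simp [dualCone]
    rw [this]
    refine isClosed_biInter fun x _ => isClosed_le continuous_const ?_
    exact Continuous.dotProduct continuous_id continuous_const
  · intro y hy hy'
    by_contra h0
    obtain ⟨x, hx⟩ := hK.2.2.2.2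
    have h1 := dual_pos hx hy h0
    have h2 := hy' x (interior_subset hx)
    rw [neg_dotProduct] at h2
    linarith
  · apply solid_of_span
    · exact fun _ hx _ hy _ _ ha hb _ => hadd _ (hsm _ ha _ hx) _ (hsm _ hb _ hy)
    · intro x _; simp
    · by_contra hne
      obtain ⟨f, hf0, hf⟩ := Submodule.exists_le_ker_of_lt_top _ (lt_top_iff_ne_top.2 hne)
      obtain ⟨z, rfl⟩ := (dotProductEquiv ℝ (Fin n)).surjective f
      have hz : ∀ y ∈ dualCone K, z ⬝ᵥ y = 0 := by
        intro y hy
        have := hf (Submodule.subset_span hy)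
        rwa [LinearMap.mem_ker, dotProductEquiv_apply_apply] at this
      have h1 : z ∈ K := by rw [← bidual hK]; intro y hy; rw [hz y hy]
      have h2 : -z ∈ K := by
        rw [← bidual hK]; intro y hy; rw [neg_dotProduct, hz y hy, neg_zero]
      exact hf0 (by rw [hK.2.2.2.1 z h1 h2, map_zero])

lemma dual_cross {n : ℕ} {K : Set (Fin n → ℝ)} (hK : IsProperCone K)
    {A : Matrix (Fin n) (Fin n) ℝ} (hA : CrossPositive K A) :
    CrossPositive (dualCone K) A.transpose := by
  intro y hy z hz h
  rw [bidual hK] at hz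
  rw [mulVec_transpose, dotProduct_comm, ← dotProduct_mulVec]
  exact hA z hz y hy (by rw [dotProduct_comm, h])

/-- One-shot positivity of the resolvent. -/
lemma resolvent_pos {n : ℕ} {K : Set (Fin n → ℝ)} (hK : IsProperCone K)
    {A : Matrix (Fin n) (Fin n) ℝ} (hA : CrossPositive K A) {s : ℝ} {x z : Fin n → ℝ}
    (hx : x ∈ interior K) (hsx : s • x - A.mulVec x ∈ interior K)
    (hz : s • z - A.mulVec z ∈ K) : z ∈ K := by
  by_contra hzK
  obtain ⟨c, hc, y, hy, hy0, hm, -, h⟩ := hitting hK hx hzK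
  have h1 := hA _ hm y hy h
  have h2 := dual_pos hsx hy hy0
  have h3 := hy _ hz
  simp only [mulVec_add, mulVec_smul, dotProduct_add, dotProduct_sub, dotProduct_smul,
    smul_eq_mul] at h h1 h2 h3
  have : s * (c * (y ⬝ᵥ x) + y ⬝ᵥ z) = 0 := by rw [h, mul_zero]
  nlinarith [mul_pos hc h2]

lemma resolvent_inj {n : ℕ} {K : Set (Fin n → ℝ)} (hK : IsProperCone K)
    {A : Matrix (Fin n) (Fin n) ℝ} (hA : CrossPositive K A) {s : ℝ} {x : Fin n → ℝ}
    (hx : x ∈ interior K) (hsx : s • x - A.mulVec x ∈ interior K) :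
    Function.Injective (s • LinearMap.id - A.mulVecLin : (Fin n → ℝ) →ₗ[ℝ] (Fin n → ℝ)) := by
  rw [← LinearMap.ker_eq_bot, LinearMap.ker_eq_bot']
  intro z hz
  simp at hz
  apply hK.2.2.2.1
  · exact resolvent_pos hK hA hx hsx (by rw [hz]; exact hK.zero_mem)
  · refine resolvent_pos hK hA hx hsx ?_
    have : s • (-z) - A.mulVec (-z) = -(s • z - A.mulVec z) := by rw [mulVec_neg]; module
    rw [this, hz, neg_zero]; exact hK.zero_mem

lemma interior_of_eq {n : ℕ} {K : Set (Fin n → ℝ)} (hK : IsProperCone K)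
    {A : Matrix (Fin n) (Fin n) ℝ} (hA : CrossPositive K A) {s : ℝ} {x : Fin n → ℝ}
    (hx : x ∈ K) (hsx : s • x - A.mulVec x ∈ interior K) : x ∈ interior K := by
  by_contra hni
  obtain ⟨y, hy, hy0, h⟩ := support hK hx hni
  have h1 := hA x hx y hy h
  have h2 := dual_pos hsx hy hy0
  rw [dotProduct_sub, dotProduct_smul, h, smul_zero] at h2
  linarith

lemma real_parts {n : ℕ} {A : Matrix (Fin n) (Fin n) ℝ} {l : ℂ} {v : Fin n → ℂ}
    (h : (A.map Complex.ofReal).mulVec v = l • v) :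
    A.mulVec (fun i => (v i).re) = l.re • (fun i => (v i).re) - l.im • (fun i => (v i).im) ∧
    A.mulVec (fun i => (v i).im) = l.im • (fun i => (v i).re) + l.re • (fun i => (v i).im) := by
  constructor
  · ext i
    have := congrArg Complex.re (congrFun h i)
    simp [mulVec, dotProduct, Complex.mul_re] at this ⊢
    exact this
  · ext i
    have := congrArg Complex.im (congrFun h i)
    simp [mulVec, dotProduct, Complex.mul_im] at this ⊢
    linarith

lemma circle_max {U W a b : ℝ} (hab : a ^ 2 + b ^ 2 = 1)
    (h : ∀ a' b' : ℝ, a' ^ 2 + b' ^ 2 = 1 → a' * U + b' * W ≤ a * U + b * W) :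
    -b * U + a * W = 0 := by
  by_contra hne
  set M := a * U + b * W with hM
  set N := -b * U + a * W with hN
  have hsq : U ^ 2 + W ^ 2 = M ^ 2 + N ^ 2 := by
    have : M ^ 2 + N ^ 2 = (a ^ 2 + b ^ 2) * (U ^ 2 + W ^ 2) := by rw [hM, hN]; ring
    rw [this, hab, one_mul]
  have hNp : 0 < N ^ 2 := by positivity
  have hp : 0 < U ^ 2 + W ^ 2 := by nlinarith [sq_nonneg M]
  set r := Real.sqrt (U ^ 2 + W ^ 2) with hr
  have hrp : 0 < r := Real.sqrt_pos.2 hp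
  have hr2 : r ^ 2 = U ^ 2 + W ^ 2 := Real.sq_sqrt hp.le
  have h1 := h (U / r) (W / r) (by field_simp; linarith)
  have h2 : U / r * U + W / r * W = r := by field_simp; linarith
  rw [h2] at h1
  nlinarith

/-- The spectral bound. -/
lemma spectral_bound {n : ℕ} {K : Set (Fin n → ℝ)} (hK : IsProperCone K)
    {A : Matrix (Fin n) (Fin n) ℝ} (hA : CrossPositive K A) {s : ℝ} {x : Fin n → ℝ}
    (hx : x ∈ interior K) (hsx : s • x - A.mulVec x ∈ interior K) {l : ℂ}
    (hl : HasEigen (A.map Complex.ofReal) l) : l.re < s := by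
  obtain ⟨v, hv0, hv⟩ := hl
  obtain ⟨hu, hw⟩ := real_parts hv
  set u : Fin n → ℝ := fun i => (v i).re with hudef
  set w : Fin n → ℝ := fun i => (v i).im with hwdef
  let C : Set (ℝ × ℝ) := {p | p.1 ^ 2 + p.2 ^ 2 = 1}
  have hCc : IsCompact C := by
    apply Metric.isCompact_of_isClosed_isBounded
    · exact isClosed_eq (by fun_prop) continuous_const
    · apply (Metric.isBounded_closedBall (x := (0 : ℝ × ℝ)) (r := 1)).subset
      rintro ⟨a, b⟩ hp
      simp only [C, Set.mem_ofPred_eq] at hp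
      rw [mem_closedBall_zero_iff, Prod.norm_def]
      apply max_le
      · rw [Real.norm_eq_abs, abs_le]; constructor <;> nlinarith [sq_nonneg b]
      · rw [Real.norm_eq_abs, abs_le]; constructor <;> nlinarith [sq_nonneg a]
  let Z : ℝ × ℝ → (Fin n → ℝ) := fun p => p.1 • u + p.2 • w
  have hZ : Continuous Z := by fun_prop
  let T : Set ℝ := {c | 0 ≤ c ∧ ∀ p ∈ C, c • x - Z p ∈ K}
  have hT : IsClosed T := by
    apply IsClosed.inter isClosed_Ici
    have : {c : ℝ | ∀ p ∈ C, c • x - Z p ∈ K} = ⋂ p ∈ C, {c : ℝ | c • x - Z p ∈ K} := by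
      ext; simp
    show IsClosed {c : ℝ | ∀ p ∈ C, c • x - Z p ∈ K}
    rw [this]
    refine isClosed_biInter fun p _ => ?_
    exact hK.1.preimage (f := fun c : ℝ => c • x - Z p) (by fun_prop)
  have hne : T.Nonempty := by
    obtain ⟨c1, hc1, h1⟩ := absorb hK hx u
    obtain ⟨c2, hc2, h2⟩ := absorb hK hx (-u)
    obtain ⟨c3, hc3, h3⟩ := absorb hK hx w
    obtain ⟨c4, hc4, h4⟩ := absorb hK hx (-w)
    have key : ∀ (q : Fin n → ℝ) (d₁ d₂ : ℝ) (_ : d₁ • x + q ∈ K) (_ : d₂ • x + -q ∈ K)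
        (_ : 0 < d₁) (_ : 0 < d₂) (a : ℝ), a ^ 2 ≤ 1 → (d₁ + d₂) • x - a • q ∈ K := by
      intro q d₁ d₂ g1 g2 p1 p2 a ha
      have hxK : x ∈ K := interior_subset hx
      have ha1 : a ≤ 1 := by nlinarith
      have ha2 : -1 ≤ a := by nlinarith
      rcases le_total 0 a with h | h
      · have : (d₁ + d₂) • x - a • q = a • (d₂ • x + -q) + (d₁ + (1 - a) * d₂) • x := by module
        rw [this]
        exact hK.2.1 _ (hK.2.2.1 _ h _ g2) _ (hK.2.2.1 _ (by nlinarith) _ hxK)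
      · have : (d₁ + d₂) • x - a • q = (-a) • (d₁ • x + q) + (d₂ + (1 + a) * d₁) • x := by module
        rw [this]
        exact hK.2.1 _ (hK.2.2.1 _ (by linarith) _ g1) _ (hK.2.2.1 _ (by nlinarith) _ hxK)
    refine ⟨(c1 + c2) + (c3 + c4), by positivity, ?_⟩
    rintro ⟨a, b⟩ hp
    simp only [C, Set.mem_ofPred_eq] at hp
    have : ((c1 + c2) + (c3 + c4)) • x - Z (a, b) =
        ((c1 + c2) • x - a • u) + ((c3 + c4) • x - b • w) := by
      simp only [Z]; module
    rw [this]
    exact hK.2.1 _ (key u c1 c2 (interior_subset (h1 _ le_rfl)) (interior_subset (h2 _ le_rfl))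
        hc1 hc2 a (by nlinarith [sq_nonneg b])) _
      (key w c3 c4 (interior_subset (h3 _ le_rfl)) (interior_subset (h4 _ le_rfl))
        hc3 hc4 b (by nlinarith [sq_nonneg a]))
  have hbb : BddBelow T := ⟨0, fun c hc => hc.1⟩
  obtain ⟨hc0, hcK⟩ := hT.csInf_mem hne hbb
  set c := sInf T with hcdef
  have hcpos : 0 < c := by
    rcases hc0.lt_or_eq with h | h
    · exact h
    · exfalso
      rw [← h] at hcK
      have e1 := hcK (1, 0) (by simp [C])
      have e2 := hcK (-1, 0) (by simp [C])
      have e3 := hcK (0, 1) (by simp [C])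
      have e4 := hcK (0, -1) (by simp [C])
      simp [Z] at e1 e2 e3 e4
      have hu0 := hK.2.2.2.1 u e2 e1
      have hw0 := hK.2.2.2.1 w e4 e3
      apply hv0
      ext i
      exact Complex.ext (congrFun hu0 i) (congrFun hw0 i)
  have hex : ∃ p ∈ C, c • x - Z p ∉ interior K := by
    by_contra hcon
    push Not at hcon
    have hcomp : IsCompact ((fun p => c • x - Z p) '' C) := hCc.image (by fun_prop)
    obtain ⟨δ, hδ, hth⟩ := hcomp.exists_thickening_subset_open isOpen_interior
      (by rintro _ ⟨p, hp, rfl⟩; exact hcon p hp)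
    set ε := min c (δ / (2 * (‖x‖ + 1))) with hε
    have hεp : 0 < ε := lt_min hcpos (by positivity)
    have hmem : c - ε ∈ T := by
      refine ⟨by linarith [min_le_left c (δ / (2 * (‖x‖ + 1)))], fun p hp => ?_⟩
      apply interior_subset
      apply hth
      rw [Metric.mem_thickening_iff]
      refine ⟨_, ⟨p, hp, rfl⟩, ?_⟩
      have : (c - ε) • x - Z p - (c • x - Z p) = (-ε) • x := by module
      rw [dist_eq_norm, this, norm_smul, norm_neg, Real.norm_eq_abs, abs_of_pos hεp]
      have h1 : ε ≤ δ / (2 * (‖x‖ + 1)) := min_le_right _ _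
      rw [le_div_iff₀ (by positivity)] at h1
      nlinarith [norm_nonneg x]
    have := csInf_le hbb hmem
    rw [← hcdef] at this
    linarith
  obtain ⟨⟨a, b⟩, hp, hni⟩ := hex
  obtain ⟨y, hy, hy0, hyp⟩ := support hK (hcK _ hp) hni
  have hcross := hA _ (hcK _ hp) y hy hyp
  have hxy := dual_pos hx hy hy0
  have hsy := dual_pos hsx hy hy0
  have hN : -b * (y ⬝ᵥ u) + a * (y ⬝ᵥ w) = 0 := by
    apply circle_max hp
    intro a' b' hab
    have h1 := hy _ (hcK (a', b') hab)
    simp only [Z, dotProduct_add, dotProduct_sub, dotProduct_smul, smul_eq_mul] at h1 hyp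
    linarith
  simp only [Z, mulVec_add, mulVec_sub, mulVec_smul, hu, hw, dotProduct_add, dotProduct_sub,
    dotProduct_smul, smul_eq_mul] at hyp hcross hsy
  have e1 : a * (l.re * y ⬝ᵥ u - l.im * y ⬝ᵥ w) + b * (l.im * y ⬝ᵥ u + l.re * y ⬝ᵥ w)
      = l.re * (c * y ⬝ᵥ x) := by
    linear_combination (-l.im) * hN - l.re * hyp
  have e2 : 0 ≤ c * (y ⬝ᵥ A.mulVec x - l.re * y ⬝ᵥ x) := by rw [e1] at hcross; linarith
  have e3 : 0 ≤ y ⬝ᵥ A.mulVec x - l.re * y ⬝ᵥ x := nonneg_of_mul_nonneg_right e2 hcpos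
  have e4 : 0 < (s - l.re) * y ⬝ᵥ x := by linarith
  nlinarith
lemma core {n : ℕ} {K : Set (Fin n → ℝ)} (hK : IsProperCone K)
    {A : Matrix (Fin n) (Fin n) ℝ} (hA : CrossPositive K A) {l : ℂ}
    (hl : HasEigen (A.map Complex.ofReal) l) :
    ∃ s : ℝ, l.re ≤ s ∧ ∃ x ∈ K, x ≠ 0 ∧ A.mulVec x = s • x := by
  obtain ⟨e, he⟩ := hK.2.2.2.2
  have step : ∀ (s : ℝ) (x : Fin n → ℝ), x ∈ interior K → s • x - A.mulVec x ∈ interior K →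
      ∃ u ∈ K, ∃ τ : ℝ, 0 ≤ τ ∧ ‖u‖ + τ = 1 ∧ s • u - A.mulVec u = τ • e := by
    intro s x hx hsx
    obtain ⟨z, hz⟩ := (LinearMap.injective_iff_surjective.1 (resolvent_inj hK hA hx hsx)) e
    simp at hz
    have hzK : z ∈ K := resolvent_pos hK hA hx hsx (by rw [hz]; exact interior_subset he)
    have hp : 0 < 1 + ‖z‖ := by positivity
    refine ⟨(1 + ‖z‖)⁻¹ • z, hK.2.2.1 _ (by positivity) _ hzK, (1 + ‖z‖)⁻¹, by positivity, ?_, ?_⟩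
    · rw [norm_smul, Real.norm_eq_abs, abs_of_pos (by positivity)]
      field_simp
      ring
    · rw [← hz, mulVec_smul]; module
  obtain ⟨M, hM, hMe⟩ := absorb hK he (-A.mulVec e)
  have hMe' : M • e - A.mulVec e ∈ interior K := by
    rw [sub_eq_add_neg]; exact hMe M le_rfl
  obtain ⟨u1, hu1, τ1, hτ1, hn1, heq1⟩ := step M e he hMe'
  have hMl := spectral_bound hK hA he hMe' hl
  let Q : Set (ℝ × (Fin n → ℝ) × ℝ) := {q | q.1 ∈ Set.Icc l.re M ∧ q.2.1 ∈ K ∧ 0 ≤ q.2.2 ∧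
    ‖q.2.1‖ + q.2.2 = 1 ∧ q.1 • q.2.1 - A.mulVec q.2.1 = q.2.2 • e}
  have hQc : IsCompact Q := by
    have hsub : Q ⊆ Set.Icc l.re M ×ˢ (Metric.closedBall (0 : Fin n → ℝ) 1 ×ˢ Set.Icc (0 : ℝ) 1) := by
      rintro ⟨s, u, τ⟩ ⟨h1, h2, h3, h4, h5⟩
      simp only at h1 h2 h3 h4
      refine ⟨h1, ?_, h3, ?_⟩
      · rw [mem_closedBall_zero_iff]; simp only; linarith
      · simp only; linarith [norm_nonneg u]
    refine IsCompact.of_isClosed_subset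
      (isCompact_Icc.prod ((isCompact_closedBall _ _).prod isCompact_Icc)) ?_ hsub
    refine IsClosed.inter (isClosed_Icc.preimage continuous_fst) ?_
    refine IsClosed.inter (hK.1.preimage (f := fun q : ℝ × (Fin n → ℝ) × ℝ => q.2.1) (by fun_prop)) ?_
    refine IsClosed.inter (isClosed_Ici.preimage (f := fun q : ℝ × (Fin n → ℝ) × ℝ => q.2.2) (by fun_prop)) ?_
    refine IsClosed.inter (isClosed_eq (by fun_prop) continuous_const) ?_
    refine isClosed_eq (Continuous.sub (by fun_prop) ?_) (by fun_prop)
    exact Continuous.matrix_mulVec continuous_const (by fun_prop)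
  have hQne : Q.Nonempty := ⟨(M, u1, τ1), ⟨hMl.le, le_rfl⟩, hu1, hτ1, hn1, heq1⟩
  obtain ⟨⟨s, u, τ⟩, ⟨hs, hu, hτ, hn, heq⟩, hmin⟩ :=
    hQc.exists_isMinOn hQne (f := fun q => q.1) (by fun_prop)
  simp only at hs hu hτ hn heq
  rcases hτ.lt_or_eq with hτp | hτ0
  · exfalso
    have hτe : s • u - A.mulVec u ∈ interior K := by
      rw [heq]
      obtain ⟨c, hc, h⟩ := absorb hK he 0
      have hint : ∀ d : ℝ, 0 < d → d • e ∈ interior K := by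
        intro d hd
        have h3 := support hK (hK.2.2.1 d hd.le e (interior_subset he))
        by_contra hni
        obtain ⟨y, hy, hy0, hz⟩ := h3 hni
        have h4 := dual_pos he hy hy0
        rw [dotProduct_smul, smul_eq_mul] at hz
        nlinarith [mul_pos hd h4]
      exact hint τ hτp
    have hui := interior_of_eq hK hA hu hτe
    obtain ⟨ε, hε, h⟩ := int_nudge hτe u
    have h1 := h (-ε) (by rw [abs_neg, abs_of_pos hε])
    have h2 : (s - ε) • u - A.mulVec u ∈ interior K := by convert h1 using 1; module
    obtain ⟨u', hu', τ', hτ', hn', heq'⟩ := step _ u hui h2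
    have h3 := spectral_bound hK hA hui h2 hl
    have h4 : s ≤ s - ε := hmin (show ((s - ε, u', τ') : ℝ × (Fin n → ℝ) × ℝ) ∈ Q from
      ⟨⟨h3.le, by simp only; linarith [hs.2]⟩, hu', hτ', hn', heq'⟩)
    linarith
  · refine ⟨s, hs.1, u, hu, ?_, ?_⟩
    · rintro rfl
      rw [norm_zero] at hn; linarith
    · rw [← hτ0, zero_smul] at heq
      exact (sub_eq_zero.1 heq).symm

lemma hasEigen_iff {n : ℕ} (M : Matrix (Fin n) (Fin n) ℂ) (l : ℂ) :
    HasEigen M l ↔ (M - l • (1 : Matrix (Fin n) (Fin n) ℂ)).det = 0 := by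
  rw [← Matrix.exists_mulVec_eq_zero_iff]
  simp only [HasEigen, sub_mulVec, smul_mulVec, one_mulVec, sub_eq_zero]

lemma hasEigen_transpose {n : ℕ} (A : Matrix (Fin n) (Fin n) ℝ) (l : ℂ) :
    HasEigen (A.transpose.map Complex.ofReal) l ↔ HasEigen (A.map Complex.ofReal) l := by
  rw [hasEigen_iff, hasEigen_iff, ← Matrix.det_transpose (A.map Complex.ofReal - _)]
  simp [Matrix.transpose_sub, Matrix.transpose_map]

lemma hasEigen_ofReal {n : ℕ} {A : Matrix (Fin n) (Fin n) ℝ} {s : ℝ} {x : Fin n → ℝ}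
    (hx : x ≠ 0) (h : A.mulVec x = s • x) : HasEigen (A.map Complex.ofReal) (s : ℂ) := by
  refine ⟨fun i => (x i : ℂ), ?_, ?_⟩
  · intro h0
    apply hx
    ext i
    have := congrFun h0 i
    simpa using this
  · ext i
    have := congrArg Complex.ofReal (congrFun h i)
    simp [mulVec, dotProduct] at this ⊢
    exact this

/-- A linear map preserving a nontrivial closed pointed convex cone has an eigenvector in it. -/
lemma cone_eigen {n : ℕ} (F : Set (Fin n → ℝ)) (hcl : IsClosed F)
    (hadd : ∀ x ∈ F, ∀ y ∈ F, x + y ∈ F) (hsm : ∀ a : ℝ, 0 ≤ a → ∀ x ∈ F, a • x ∈ F)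
    (hpt : ∀ x, x ∈ F → -x ∈ F → x = 0) {z : Fin n → ℝ} (hz : z ∈ F) (hz0 : z ≠ 0)
    (R : (Fin n → ℝ) →ₗ[ℝ] (Fin n → ℝ)) (hR : ∀ x ∈ F, R x ∈ F) :
    ∃ x ∈ F, x ≠ 0 ∧ ∃ s : ℝ, R x = s • x := by
  let V := Submodule.span ℝ F
  have hRV : ∀ x ∈ V, R x ∈ V := by
    intro x hx
    have : V ≤ V.comap R := Submodule.span_le.2 fun x hx => Submodule.subset_span (hR x hx)
    exact this hx
  let m := Module.finrank ℝ V
  let φ : V ≃ₗ[ℝ] (Fin m → ℝ) := (Module.finBasis ℝ V).equivFun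
  let ψ : (Fin m → ℝ) →ₗ[ℝ] (Fin n → ℝ) := V.subtype.comp φ.symm.toLinearMap
  have hψi : Function.Injective ψ := V.injective_subtype.comp φ.symm.injective
  let F' : Set (Fin m → ℝ) := ψ ⁻¹' F
  let R' : (Fin m → ℝ) →ₗ[ℝ] (Fin m → ℝ) := φ.toLinearMap ∘ₗ (R.restrict hRV) ∘ₗ φ.symm.toLinearMap
  have hψR : ∀ w, ψ (R' w) = R (ψ w) := by
    intro w
    simp [ψ, R']
  have h0F : (0 : Fin n → ℝ) ∈ F := by simpa using hsm 0 le_rfl z hz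
  have hadd' : ∀ x ∈ F', ∀ y ∈ F', x + y ∈ F' := by
    intro x hx y hy
    show ψ (x + y) ∈ F
    rw [map_add]; exact hadd _ hx _ hy
  have hsm' : ∀ a : ℝ, 0 ≤ a → ∀ x ∈ F', a • x ∈ F' := by
    intro a ha x hx
    show ψ (a • x) ∈ F
    rw [map_smul]; exact hsm a ha _ hx
  have hproper : IsProperCone F' := by
    refine ⟨hcl.preimage ψ.continuous_of_finiteDimensional, hadd', hsm', ?_, ?_⟩
    · intro x hx hx'
      apply hψi
      rw [map_zero]
      refine hpt _ hx ?_
      rw [← map_neg]; exact hx'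
    · apply solid_of_span
      · exact fun _ hx _ hy _ _ ha hb _ => hadd' _ (hsm' _ ha _ hx) _ (hsm' _ hb _ hy)
      · show ψ 0 ∈ F
        rw [map_zero]; exact h0F
      · have h1 : F' = φ '' ((fun v : V => (v : Fin n → ℝ)) ⁻¹' F) := by
          rw [LinearEquiv.image_eq_preimage_symm]; rfl
        have h2 := Submodule.span_span_coe_preimage (R := ℝ) (s := F)
        rw [h1]
        have h3 := Submodule.span_image (s := ((fun v : V => (v : Fin n → ℝ)) ⁻¹' F)) φ.toLinearMap
        refine h3.trans ?_
        have h4 : Submodule.span ℝ ((fun v : V => (v : Fin n → ℝ)) ⁻¹' F) = ⊤ := h2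
        rw [h4, Submodule.map_top, LinearEquiv.range]
  let A' := LinearMap.toMatrix' R'
  have hA'v : ∀ w, A'.mulVec w = R' w := fun w => by
    simp only [A', LinearMap.toMatrix'_mulVec]
  have hcross : CrossPositive F' A' := by
    intro x hx y hy _
    apply hy
    rw [hA'v]
    show ψ (R' x) ∈ F
    rw [hψR]; exact hR _ hx
  have hnt : Nontrivial (Fin m → ℂ) := by
    have : Nontrivial V := ⟨⟨⟨z, Submodule.subset_span hz⟩, 0, by
      intro h; exact hz0 (congrArg Subtype.val h)⟩⟩
    have hm : 0 < m := Module.finrank_pos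
    have : Nonempty (Fin m) := ⟨⟨0, hm⟩⟩
    infer_instance
  obtain ⟨l, hl⟩ := Module.End.exists_eigenvalue (A'.map Complex.ofReal).mulVecLin
  obtain ⟨v, hv⟩ := hl.exists_hasEigenvector
  have hE : HasEigen (A'.map Complex.ofReal) l := ⟨v, hv.2, hv.apply_eq_smul⟩
  obtain ⟨s, -, x, hx, hx0, h⟩ := core hproper hcross hE
  refine ⟨ψ x, hx, ?_, s, ?_⟩
  · intro h; exact hx0 (hψi (by rw [h, map_zero]))
  · rw [← hψR, ← hA'v, h, map_smul]

lemma simple_of {n : ℕ} {A : Matrix (Fin n) (Fin n) ℝ} {μ : ℝ} {x y : Fin n → ℝ}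
    (hx0 : x ≠ 0) (hx : A.mulVec x = μ • x) (hy : A.transpose.mulVec y = μ • y)
    (hyx : y ⬝ᵥ x ≠ 0) (hgeo : ∀ v, A.mulVec v = μ • v → ∃ c : ℝ, v = c • x) :
    Polynomial.rootMultiplicity (μ : ℂ) (Matrix.charpoly (A.map Complex.ofReal)) = 1 := by
  have h1 : (A.map Complex.ofReal).charpoly = A.charpoly.map Complex.ofRealHom :=
    Matrix.charpoly_map A Complex.ofRealHom
  rw [h1]
  have h2 := Polynomial.eq_rootMultiplicity_map (p := A.charpoly) (f := Complex.ofRealHom)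
    Complex.ofReal_injective μ
  refine h2.symm.trans ?_
  rw [← Matrix.charpoly_mulVecLin, ← LinearMap.finrank_maxGenEigenspace_eq]
  have hspan : Module.End.maxGenEigenspace A.mulVecLin μ = Submodule.span ℝ {x} := by
    apply le_antisymm
    · intro v hv
      obtain ⟨k, hk⟩ := (Module.End.mem_maxGenEigenspace _ _ _).1 hv
      have key : ∀ k : ℕ, ((A.mulVecLin - μ • 1) ^ (k + 1)) v = 0 →
          (A.mulVecLin - μ • (1 : Module.End ℝ (Fin n → ℝ))) v = 0 := by
        intro k
        induction k with
        | zero => intro h; simpa using h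
        | succ k ih =>
          intro h
          apply ih
          set w := ((A.mulVecLin - μ • 1) ^ k) v with hw
          have e1 : ((A.mulVecLin - μ • 1) ^ (k + 1)) v = A.mulVec w - μ • w := by
            rw [pow_succ', Module.End.mul_apply, ← hw]; simp
          rw [pow_succ', Module.End.mul_apply, e1] at h
          rw [e1]
          simp only [LinearMap.sub_apply, LinearMap.smul_apply, Module.End.one_apply,
            mulVecLin_apply, sub_eq_zero] at h
          obtain ⟨c, hc⟩ := hgeo _ h
          have e2 : y ⬝ᵥ (A.mulVec w - μ • w) = 0 := by
            rw [dotProduct_sub, dotProduct_mulVec, ← mulVec_transpose, hy, dotProduct_smul,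
              smul_dotProduct, sub_self]
          rw [hc, dotProduct_smul, smul_eq_mul] at e2
          rcases mul_eq_zero.1 e2 with h | h
          · rw [hc, h, zero_smul]
          · exact absurd h hyx
      have h3 : (A.mulVecLin - μ • (1 : Module.End ℝ (Fin n → ℝ))) v = 0 := by
        apply key k
        rw [pow_succ', Module.End.mul_apply, hk, map_zero]
      simp only [LinearMap.sub_apply, LinearMap.smul_apply, Module.End.one_apply,
            mulVecLin_apply, sub_eq_zero] at h3
      obtain ⟨c, hc⟩ := hgeo _ h3
      exact Submodule.mem_span_singleton.2 ⟨c, hc.symm⟩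
    · rw [Submodule.span_singleton_le_iff_mem, Module.End.mem_maxGenEigenspace]
      exact ⟨1, by simp [hx]⟩
  rw [hspan, finrank_span_singleton hx0]

/-- Perron–Frobenius-type theorem for cross-positive matrices over a proper cone `K`:
`μ = max{Re λ : λ eigenvalue of A}` is itself an eigenvalue of `A`, with right- and
left-eigenvectors in `K` and `K*` respectively; and if moreover `A` is `K`-irreducible
(no eigenvector of `A` lies on the boundary of `K`), then `μ` is a simple root of the
characteristic polynomial and the eigenvectors may be chosen in the interiors of `K`
and `K*`. -/
theorem stmt2 {n : ℕ} (K : Set (Fin n → ℝ)) (hK : IsProperCone K)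
    (A : Matrix (Fin n) (Fin n) ℝ) (hA : CrossPositive K A)
    (μ : ℝ)
    (hμmax : ∀ z : ℂ, HasEigen (A.map Complex.ofReal) z → z.re ≤ μ)
    (hμmem : ∃ z : ℂ, HasEigen (A.map Complex.ofReal) z ∧ z.re = μ) :
    HasEigen (A.map Complex.ofReal) (μ : ℂ) ∧
    (∃ x ∈ K, x ≠ 0 ∧ A.mulVec x = μ • x) ∧
    (∃ y ∈ dualCone K, y ≠ 0 ∧ A.transpose.mulVec y = μ • y) ∧
    ((¬ ∃ v : Fin n → ℝ, v ≠ 0 ∧ v ∈ frontier K ∧ ∃ μ' : ℝ, A.mulVec v = μ' • v) →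
      Polynomial.rootMultiplicity (μ : ℂ) (Matrix.charpoly (A.map Complex.ofReal)) = 1 ∧
      (∃ x ∈ interior K, A.mulVec x = μ • x) ∧
      (∃ y ∈ interior (dualCone K), A.transpose.mulVec y = μ • y)) := by
  have hleft : ∃ x ∈ K, x ≠ 0 ∧ A.mulVec x = μ • x := by
    obtain ⟨z, hz, hzre⟩ := hμmem
    obtain ⟨s, hs, x, hx, hx0, h⟩ := core hK hA hz
    have h1 : s ≤ μ := by simpa using hμmax _ (hasEigen_ofReal hx0 h)
    have h2 : s = μ := le_antisymm h1 (hzre ▸ hs)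
    exact ⟨x, hx, hx0, h2 ▸ h⟩
  have hright : ∃ y ∈ dualCone K, y ≠ 0 ∧ A.transpose.mulVec y = μ • y := by
    obtain ⟨z, hz, hzre⟩ := hμmem
    obtain ⟨s, hs, y, hy, hy0, h⟩ :=
      core (dual_proper hK) (dual_cross hK hA) ((hasEigen_transpose A z).2 hz)
    have h1 : s ≤ μ := by
      simpa using hμmax _ ((hasEigen_transpose A _).1 (hasEigen_ofReal hy0 h))
    have h2 : s = μ := le_antisymm h1 (hzre ▸ hs)
    exact ⟨y, hy, hy0, h2 ▸ h⟩
  refine ⟨?_, hleft, hright, fun hirr => ?_⟩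
  · obtain ⟨x, -, hx0, h⟩ := hleft
    exact hasEigen_ofReal hx0 h
  obtain ⟨x, hxK, hx0, hx⟩ := hleft
  obtain ⟨y, hyK, hy0, hy⟩ := hright
  have hfr : ∀ v ∈ K, v ∉ interior K → v ∈ frontier K := by
    intro v hv hv'
    exact ⟨subset_closure hv, hv'⟩
  have hxi : x ∈ interior K := by
    by_contra hni
    exact hirr ⟨x, hx0, hfr x hxK hni, μ, hx⟩
  have hgeo' : ∀ v, A.mulVec v = μ • v → v ∉ K → ∃ c : ℝ, v = c • x := by
    intro v hv hvK
    obtain ⟨c, hc, -, -, -, hm, hni, -⟩ := hitting hK hxi hvK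
    by_cases h0 : c • x + v = 0
    · exact ⟨-c, by rw [neg_smul]; exact eq_neg_of_add_eq_zero_right h0⟩
    · exact absurd ⟨c • x + v, h0, hfr _ hm hni, μ, by
        rw [mulVec_add, mulVec_smul, hx, hv]; module⟩ hirr
  have hgeo : ∀ v, A.mulVec v = μ • v → ∃ c : ℝ, v = c • x := by
    intro v hv
    by_cases h1 : v ∈ K
    · by_cases h2 : -v ∈ K
      · exact ⟨0, by rw [hK.2.2.2.1 v h1 h2, zero_smul]⟩
      · obtain ⟨c, hc⟩ := hgeo' (-v) (by rw [mulVec_neg, hv, smul_neg]) h2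
        exact ⟨-c, by rw [neg_smul, ← hc, neg_neg]⟩
    · exact hgeo' v hv h1
  refine ⟨simple_of hx0 hx hy (dual_pos hxi hyK hy0).ne' hgeo, ⟨x, hxi, hx⟩, y, ?_, hy⟩
  by_contra hyni
  obtain ⟨z, hz, hz0, hzy⟩ := support (dual_proper hK) hyK hyni
  rw [bidual hK] at hz
  -- a large real number at which the resolvent is positive
  obtain ⟨s, -, hs⟩ := absorb hK hxi (-A.mulVec x)
  have hsx : s • x - A.mulVec x ∈ interior K := by
    rw [sub_eq_add_neg]; exact hs s le_rfl
  have hinj := resolvent_inj hK hA hxi hsx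
  let E := LinearEquiv.ofInjectiveEndo _ hinj
  have hE : ∀ w, s • E.symm w - A.mulVec (E.symm w) = w := fun w => by
    have : E (E.symm w) = w := E.apply_symm_apply w
    exact this
  have hsμ : μ < s := by
    have h1 := dual_pos hsx hyK hy0
    have h2 := dual_pos hxi hyK hy0
    rw [hx, ← sub_smul, dotProduct_smul, smul_eq_mul] at h1
    by_contra hle
    push Not at hle
    nlinarith
  obtain ⟨w, ⟨hwK, hyw⟩, hw0, r, hr⟩ := cone_eigen (K ∩ {w | y ⬝ᵥ w = 0})
    (hK.1.inter (isClosed_eq (Continuous.dotProduct continuous_const continuous_id)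
      continuous_const))
    (by
      rintro a ⟨ha, ha'⟩ b ⟨hb, hb'⟩
      refine ⟨hK.2.1 a ha b hb, ?_⟩
      show y ⬝ᵥ (a + b) = 0
      rw [dotProduct_add, show y ⬝ᵥ a = 0 from ha', show y ⬝ᵥ b = 0 from hb', add_zero])
    (by
      rintro c hc a ⟨ha, ha'⟩
      refine ⟨hK.2.2.1 c hc a ha, ?_⟩
      show y ⬝ᵥ (c • a) = 0
      rw [dotProduct_smul, show y ⬝ᵥ a = 0 from ha', smul_zero])
    (fun a ha ha' => hK.2.2.2.1 a ha.1 ha'.1)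
    (z := z) ⟨hz, by show y ⬝ᵥ z = 0; rw [dotProduct_comm]; exact hzy⟩ hz0
    E.symm.toLinearMap
    (by
      rintro a ⟨ha, ha'⟩
      refine ⟨resolvent_pos hK hA hxi hsx (by
        show s • E.symm a - A.mulVec (E.symm a) ∈ K
        rw [hE]; exact ha), ?_⟩
      show y ⬝ᵥ E.symm a = 0
      have h1 : y ⬝ᵥ (s • E.symm a - A.mulVec (E.symm a)) = 0 := by rw [hE]; exact ha'
      rw [dotProduct_sub, dotProduct_mulVec, ← mulVec_transpose, hy, dotProduct_smul,
        smul_dotProduct, ← sub_smul, smul_eq_mul] at h1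
      exact (mul_eq_zero.1 h1).resolve_left (by linarith))
  have hr' : E.symm w = r • w := hr
  have hr0 : r ≠ 0 := by
    rintro rfl
    rw [zero_smul] at hr'
    exact hw0 (by simpa using hr')
  have h1 := hE w
  rw [hr', mulVec_smul] at h1
  refine hirr ⟨w, hw0, hfr w hwK ?_, s - r⁻¹, ?_⟩
  · intro hwi
    exact (dual_pos hwi hyK hy0).ne' hyw
  · have h2 : r • A.mulVec w = r • ((s - r⁻¹) • w) := by
      have h3 : r • ((s - r⁻¹) • w) = s • r • w - (r * r⁻¹) • w := by module
      rw [h3, mul_inv_cancel₀ hr0, one_smul]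
      rw [← sub_eq_zero] at h1 ⊢
      rw [← neg_eq_zero, ← h1]; abel
    exact smul_right_injective _ hr0 h2
end

section
/- Let A ∈ ℝ^{n×n} be Hurwitz stable and K ⊆ ℝⁿ a proper cone. Then for every s₀ ≥ 0 the matrix s₀I − A is invertible, and the following are equivalent: (i) (s₀I − A)^{-1}K ⊆ K for every s₀ ≥ 0; (ii) A is cross-positive over K. -/
open Matrix

/-- `A` is Hurwitz stable: every complex eigenvalue has negative real part. -/
def Hurwitz {n : ℕ} (A : Matrix (Fin n) (Fin n) ℝ) : Prop :=
  ∀ μ : ℂ, HasEigen (A.map Complex.ofReal) μ → μ.re < 0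

theorem aux_isUnit {n : ℕ} (A : Matrix (Fin n) (Fin n) ℝ) (hA : Hurwitz A) (s : ℝ) (hs : 0 ≤ s) :
    IsUnit (s • (1 : Matrix (Fin n) (Fin n) ℝ) - A) := by
  rw [Matrix.isUnit_iff_isUnit_det, isUnit_iff_ne_zero]
  intro h
  obtain ⟨v, hv, hv0⟩ := Matrix.exists_mulVec_eq_zero_iff.mpr h
  rw [Matrix.sub_mulVec, Matrix.smul_mulVec, Matrix.one_mulVec, sub_eq_zero] at hv0
  have := hA (s : ℂ) ⟨fun i => (v i : ℂ), ?_, ?_⟩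
  · simp at this
    linarith
  · intro h0
    apply hv
    funext i
    have := congrFun h0 i
    simpa using this
  · funext i
    have := congrFun hv0 i
    simp only [Matrix.mulVec, dotProduct, Pi.smul_apply, smul_eq_mul, Matrix.map_apply] at this ⊢
    rw [← Complex.ofReal_mul, this]
    push_cast
    rfl

theorem aux_support {n : ℕ} (K : Set (Fin n → ℝ)) (hK : IsProperCone K) (u : Fin n → ℝ)
    (hu : u ∈ K) (hu' : u ∉ interior K) :
    ∃ y ∈ dualCone K, y ⬝ᵥ u = 0 ∧ ∀ a ∈ interior K, 0 < y ⬝ᵥ a := by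
  obtain ⟨hcl, hadd, hsm, -, hne⟩ := hK
  have hconv : Convex ℝ K := by
    intro x hx y hy a b ha hb _
    exact hadd _ (hsm a ha x hx) _ (hsm b hb y hy)
  obtain ⟨f, hf⟩ := geometric_hahn_banach_open_point hconv.interior isOpen_interior hu'
  have hle : ∀ a ∈ K, f a ≤ f u := by
    have h1 : closure (interior K) ⊆ {a | f a ≤ f u} :=
      closure_minimal (fun a ha => (hf a ha).le) (isClosed_le f.continuous continuous_const)
    intro a ha
    apply h1
    rw [hconv.closure_interior_eq_closure_of_nonempty_interior hne]
    exact subset_closure ha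
  have h2 := hle _ (hsm 2 (by norm_num) u hu)
  have h0 := hle _ (hsm 0 le_rfl u hu)
  simp at h2 h0
  have hfu : f u = 0 := by linarith
  have hrep : ∀ a, (fun i => - f (Pi.single i 1)) ⬝ᵥ a = - f a := by
    intro a
    have h := LinearMap.pi_apply_eq_sum_univ (f : (Fin n → ℝ) →ₗ[ℝ] ℝ) a
    have h3 : f a = ∑ i, a i • f (Pi.single i 1) := by
      refine h.trans (Finset.sum_congr rfl fun i _ => ?_)
      have h4 : (fun j => if i = j then (1 : ℝ) else 0) = Pi.single i 1 := by
        funext j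
        simp [Pi.single_apply, eq_comm]
      rw [h4]
      rfl
    rw [h3, dotProduct, ← Finset.sum_neg_distrib]
    refine Finset.sum_congr rfl fun i _ => ?_
    simp [mul_comm]
  refine ⟨fun i => - f (Pi.single i 1), ?_, ?_, ?_⟩
  · intro a ha
    rw [hrep]
    have := hle a ha
    linarith
  · rw [hrep, hfu, neg_zero]
  · intro a ha
    rw [hrep]
    have := hf a ha
    linarith

theorem aux_cont {n : ℕ} {X : Type*} [TopologicalSpace X] (M : X → Matrix (Fin n) (Fin n) ℝ)
    (hM : Continuous M) (x₀ : X) (h : IsUnit (M x₀)) (v : Fin n → ℝ) :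
    ContinuousAt (fun x => ((M x)⁻¹).mulVec v) x₀ := by
  have hd : (M x₀).det ≠ 0 := by
    rwa [Matrix.isUnit_iff_isUnit_det, isUnit_iff_ne_zero] at h
  have h1 : ∀ x, ((M x)⁻¹).mulVec v = ((M x).det)⁻¹ • ((M x).adjugate.mulVec v) := by
    intro x
    rw [Matrix.inv_def, Ring.inverse_eq_inv', Matrix.smul_mulVec]
  simp only [h1]
  refine ContinuousAt.smul (f := fun x => ((M x).det)⁻¹) (g := fun x => (M x).adjugate.mulVec v) ?_ ?_
  · exact (hM.matrix_det.continuousAt).inv₀ hd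
  · exact (hM.matrix_adjugate.matrix_mulVec continuous_const).continuousAt

theorem aux_R {n : ℕ} (A : Matrix (Fin n) (Fin n) ℝ) (v : Fin n → ℝ) :
    Filter.Tendsto (fun t : ℝ => ((1 - t • A)⁻¹).mulVec v) (nhdsWithin 0 (Set.Ioi 0)) (nhds v) := by
  have h := aux_cont (fun t : ℝ => 1 - t • A) (by fun_prop) 0 (by simp) v
  have h2 := h.tendsto
  simp only [zero_smul, sub_zero, inv_one, Matrix.one_mulVec] at h2
  exact h2.mono_left nhdsWithin_le_nhds

theorem aux_scale {n : ℕ} (A : Matrix (Fin n) (Fin n) ℝ) (hA : Hurwitz A) (t : ℝ) (ht : 0 < t) :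
    IsUnit (1 - t • A) ∧ (1 - t • A)⁻¹ = t⁻¹ • (t⁻¹ • (1 : Matrix (Fin n) (Fin n) ℝ) - A)⁻¹ := by
  have hu := aux_isUnit A hA t⁻¹ (by positivity)
  have he : 1 - t • A = t • (t⁻¹ • (1 : Matrix (Fin n) (Fin n) ℝ) - A) := by
    rw [smul_sub, smul_smul, mul_inv_cancel₀ ht.ne', one_smul]
  rw [Matrix.isUnit_iff_isUnit_det] at hu
  have hm : (1 - t • A) * (t⁻¹ • (t⁻¹ • (1 : Matrix (Fin n) (Fin n) ℝ) - A)⁻¹) = 1 := by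
    rw [he, Matrix.smul_mul, Matrix.mul_smul, smul_smul, mul_inv_cancel₀ ht.ne', one_smul,
      Matrix.mul_nonsing_inv _ hu]
  exact ⟨(Matrix.isUnit_iff_isUnit_det _).2 (Matrix.isUnit_det_of_right_inverse hm),
    Matrix.inv_eq_right_inv hm⟩

/-- For a Hurwitz stable `A` and a proper cone `K`: `s₀ I − A` is invertible for all
`s₀ ≥ 0`, and `(s₀ I − A)⁻¹ K ⊆ K` for every `s₀ ≥ 0` if and only if `A` is
cross-positive over `K`. -/
theorem stmt6 {n : ℕ} (K : Set (Fin n → ℝ)) (hK : IsProperCone K)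
    (A : Matrix (Fin n) (Fin n) ℝ) (hA : Hurwitz A) :
    (∀ s₀ : ℝ, 0 ≤ s₀ → IsUnit (s₀ • (1 : Matrix (Fin n) (Fin n) ℝ) - A)) ∧
    ((∀ s₀ : ℝ, 0 ≤ s₀ → ∀ x ∈ K,
        ((s₀ • (1 : Matrix (Fin n) (Fin n) ℝ) - A)⁻¹).mulVec x ∈ K)
      ↔ CrossPositive K A) := by
  refine ⟨aux_isUnit A hA, ?_, ?_⟩
  · intro h x hx y hy hyx
    have hlim : Filter.Tendsto (fun t : ℝ => y ⬝ᵥ ((1 - t • A)⁻¹).mulVec (A.mulVec x))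
        (nhdsWithin 0 (Set.Ioi 0)) (nhds (y ⬝ᵥ A.mulVec x)) := by
      have hc : Continuous (fun w : Fin n → ℝ => y ⬝ᵥ w) := by fun_prop
      exact (hc.tendsto _).comp (aux_R A (A.mulVec x))
    refine ge_of_tendsto hlim ?_
    filter_upwards [self_mem_nhdsWithin] with t ht
    have ht : 0 < t := ht
    obtain ⟨hu, he⟩ := aux_scale A hA t ht
    have h1 : 0 ≤ y ⬝ᵥ ((1 - t • A)⁻¹).mulVec x := by
      rw [he, Matrix.smul_mulVec, dotProduct_smul]
      exact mul_nonneg (by positivity) (hy _ (h _ (by positivity) x hx))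
    have h2 : ((1 - t • A)⁻¹).mulVec x = x + t • ((1 - t • A)⁻¹).mulVec (A.mulVec x) := by
      have h3 : ((1 - t • A)⁻¹).mulVec ((1 - t • A).mulVec x) = x := by
        rw [Matrix.mulVec_mulVec, Matrix.nonsing_inv_mul _ ((Matrix.isUnit_iff_isUnit_det _).1 hu),
          Matrix.one_mulVec]
      rw [Matrix.sub_mulVec, Matrix.mulVec_sub, Matrix.one_mulVec, Matrix.smul_mulVec,
        Matrix.mulVec_smul] at h3
      exact sub_eq_iff_eq_add.1 h3
    rw [h2, dotProduct_add, hyx, zero_add, dotProduct_smul] at h1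
    exact nonneg_of_mul_nonneg_right h1 ht
  · intro hcp
    have hKc := hK
    obtain ⟨hcl, hadd, hsm, -, hne⟩ := hKc
    have hconv : Convex ℝ K := by
      intro x hx y hy a b ha hb _
      exact hadd _ (hsm a ha x hx) _ (hsm b hb y hy)
    have main : ∀ x ∈ interior K, ∀ s : ℝ, 0 ≤ s →
        ((s • (1 : Matrix (Fin n) (Fin n) ℝ) - A)⁻¹).mulVec x ∈ K := by
      intro x hx
      let u : Set.Ici (0 : ℝ) → (Fin n → ℝ) := fun s =>
        (((s : ℝ) • (1 : Matrix (Fin n) (Fin n) ℝ) - A)⁻¹).mulVec x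
      have hu : Continuous u := continuous_iff_continuousAt.2 fun s =>
        aux_cont (fun s : Set.Ici (0 : ℝ) => (s : ℝ) • (1 : Matrix (Fin n) (Fin n) ℝ) - A)
          (by fun_prop) s (aux_isUnit A hA s s.2) x
      have hint : u ⁻¹' K = u ⁻¹' (interior K) := by
        apply Set.Subset.antisymm _ (Set.preimage_mono interior_subset)
        intro s hs
        by_contra hs'
        obtain ⟨y, hy, hyu, hpos⟩ := aux_support K hK (u s) hs hs'
        have h1 := hcp _ hs y hy hyu
        have h2 := hpos x hx
        have h3 : ((s : ℝ) • (1 : Matrix (Fin n) (Fin n) ℝ) - A).mulVec (u s) = x := by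
          simp only [u]
          rw [Matrix.mulVec_mulVec, Matrix.mul_nonsing_inv _
            ((Matrix.isUnit_iff_isUnit_det _).1 (aux_isUnit A hA s s.2)), Matrix.one_mulVec]
        rw [← h3, Matrix.sub_mulVec, Matrix.smul_mulVec, Matrix.one_mulVec, dotProduct_sub,
          dotProduct_smul, hyu, smul_zero] at h2
        linarith
      have hclopen : IsClopen (u ⁻¹' K) :=
        ⟨hcl.preimage hu, by rw [hint]; exact isOpen_interior.preimage hu⟩
      have hnon : (u ⁻¹' K).Nonempty := by
        have hev := (aux_R A x).eventually (isOpen_interior.mem_nhds hx)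
        obtain ⟨t, hti, ht⟩ := (hev.and self_mem_nhdsWithin).exists
        have ht : 0 < t := ht
        have hti := interior_subset hti
        rw [(aux_scale A hA t ht).2, Matrix.smul_mulVec] at hti
        have h4 := hsm t ht.le _ hti
        rw [smul_smul, mul_inv_cancel₀ ht.ne', one_smul] at h4
        exact ⟨⟨t⁻¹, (inv_pos.2 ht).le⟩, h4⟩
      haveI : PreconnectedSpace (Set.Ici (0 : ℝ)) := Subtype.preconnectedSpace isPreconnected_Ici
      have huniv := hclopen.eq_univ hnon
      intro s hs
      have : (⟨s, hs⟩ : Set.Ici (0 : ℝ)) ∈ u ⁻¹' K := by rw [huniv]; trivial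
      exact this
    intro s hs x hx
    have h1 : closure (interior K) ⊆
        {x | ((s • (1 : Matrix (Fin n) (Fin n) ℝ) - A)⁻¹).mulVec x ∈ K} :=
      closure_minimal (fun a ha => main a ha s hs)
        (hcl.preimage (continuous_const.matrix_mulVec continuous_id))
    apply h1
    rw [hconv.closure_interior_eq_closure_of_nonempty_interior hne]
    exact subset_closure hx
end

section
/- Let A ∈ ℝ^{n×n} be a Metzler matrix (all off-diagonal entries nonnegative) that is irreducible and Hurwitz stable. Then for every s₀ ≥ 0 the matrix s₀I − A is invertible and every entry of (s₀I − A)^{-1} is strictly positive. Consequently, for the stable positive system ẋ = Ax + e_i d, y = e_jᵀx, the defense that places a single sensor at any state coordinate e_j prevents every zero-dynamics attack d(t) = −e^{s₀t}d₀ entering through any actuator coordinate e_i. -/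
open Matrix

/-- The digraph of `A` (edge `(i,j)` whenever `i ≠ j` and `A i j ≠ 0`) is strongly
connected; this is equivalent to irreducibility of `A`. -/
def StronglyConnected {n : ℕ} (A : Matrix (Fin n) (Fin n) ℝ) : Prop :=
  ∀ i j : Fin n, Relation.ReflTransGen (fun a b => a ≠ b ∧ A a b ≠ 0) i j


/-- nonneg solutions are strictly positive -/
lemma aux_pos {n : ℕ} (A : Matrix (Fin n) (Fin n) ℝ)
    (hMetzler : ∀ i j, i ≠ j → 0 ≤ A i j) (hIrr : StronglyConnected A) (s : ℝ)
    (x b : Fin n → ℝ) (hx : ∀ i, 0 ≤ x i) (hb : ∀ i, 0 ≤ b i) (hx0 : x ≠ 0)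
    (h : ∀ i, s * x i - ∑ k, A i k * x k = b i) : ∀ i, 0 < x i := by
  intro i
  by_contra hi
  have hi0 : x i = 0 := le_antisymm (not_lt.mp hi) (hx i)
  apply hx0
  funext k
  have hp := hIrr i k
  induction hp with
  | refl => exact hi0
  | tail _ hab ih =>
    rename_i b' c _
    obtain ⟨hne, hA⟩ := hab
    have ih' : x b' = 0 := ih
    have h1 := h b'
    rw [ih'] at h1
    have hnn : ∀ k ∈ Finset.univ, 0 ≤ A b' k * x k := by
      intro k _
      by_cases hk : b' = k
      · subst hk; simp [ih']
      · exact mul_nonneg (hMetzler _ _ hk) (hx k)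
    have h2 : ∑ k, A b' k * x k = 0 :=
      le_antisymm (by linarith [hb b']) (Finset.sum_nonneg hnn)
    have h3 := (Finset.sum_eq_zero_iff_of_nonneg hnn).1 h2 c (Finset.mem_univ _)
    exact (mul_eq_zero.1 h3).resolve_left hA

/-- for large `s` solutions are nonnegative -/
lemma aux_large {n : ℕ} (A : Matrix (Fin n) (Fin n) ℝ)
    (hMetzler : ∀ i j, i ≠ j → 0 ≤ A i j) (s : ℝ) (hs : ∀ i, ∑ k, A i k < s)
    (x b : Fin n → ℝ) (hb : ∀ i, 0 ≤ b i)
    (h : ∀ i, s * x i - ∑ k, A i k * x k = b i) : ∀ i, 0 ≤ x i := by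
  intro i0
  obtain ⟨i, _, hi⟩ := Finset.exists_min_image Finset.univ x ⟨i0, Finset.mem_univ _⟩
  refine le_trans ?_ (hi i0 (Finset.mem_univ _))
  by_contra hneg
  have h1 : (∑ k, A i k) * x i ≤ ∑ k, A i k * x k := by
    rw [Finset.sum_mul]
    apply Finset.sum_le_sum
    intro k _
    by_cases hk : i = k
    · subst hk; exact le_rfl
    · exact mul_le_mul_of_nonneg_left (hi k (Finset.mem_univ _)) (hMetzler _ _ hk)
  have h2 := h i
  have h3 := hb i
  nlinarith [mul_pos (sub_pos.2 (hs i)) (neg_pos.2 (not_le.1 hneg))]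

lemma aux_unit {n : ℕ} (A : Matrix (Fin n) (Fin n) ℝ) (hHur : Hurwitz A) (s : ℝ) (hs : 0 ≤ s) :
    IsUnit (s • (1 : Matrix (Fin n) (Fin n) ℝ) - A) := by
  rw [Matrix.isUnit_iff_isUnit_det, isUnit_iff_ne_zero]
  intro hdet
  obtain ⟨v, hv0, hv⟩ := Matrix.exists_mulVec_eq_zero_iff.2 hdet
  have hv' : A.mulVec v = s • v := by
    rw [Matrix.sub_mulVec, Matrix.smul_mulVec, Matrix.one_mulVec, sub_eq_zero] at hv
    exact hv.symm
  have := hHur (s : ℂ) ⟨fun i => (v i : ℂ), ?_, ?_⟩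
  · simp at this; linarith
  · intro h0
    apply hv0
    funext i
    have := congrFun h0 i
    simpa using this
  · funext i
    have := congrArg (fun r : ℝ => (r : ℂ)) (congrFun hv' i)
    simpa [Matrix.mulVec, dotProduct] using this

lemma aux_eq {n : ℕ} (A : Matrix (Fin n) (Fin n) ℝ) (s : ℝ)
    (hu : IsUnit (s • (1 : Matrix (Fin n) (Fin n) ℝ) - A)) (j i : Fin n) :
    s * (s • (1 : Matrix (Fin n) (Fin n) ℝ) - A)⁻¹ i j
      - ∑ k, A i k * (s • (1 : Matrix (Fin n) (Fin n) ℝ) - A)⁻¹ k j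
      = (1 : Matrix (Fin n) (Fin n) ℝ) i j := by
  have h := Matrix.mul_nonsing_inv _ ((Matrix.isUnit_iff_isUnit_det _).1 hu)
  set N := (s • (1 : Matrix (Fin n) (Fin n) ℝ) - A)⁻¹
  rw [← h, Matrix.sub_mul, Matrix.smul_mul, Matrix.one_mul]
  simp [Matrix.mul_apply]

lemma aux_one {n : ℕ} (i j : Fin n) : 0 ≤ (1 : Matrix (Fin n) (Fin n) ℝ) i j := by
  rw [Matrix.one_apply]; split_ifs <;> norm_num

lemma aux_strict {n : ℕ} (A : Matrix (Fin n) (Fin n) ℝ)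
    (hMetzler : ∀ i j, i ≠ j → 0 ≤ A i j) (hIrr : StronglyConnected A) (s : ℝ)
    (hu : IsUnit (s • (1 : Matrix (Fin n) (Fin n) ℝ) - A))
    (hnn : ∀ i j, 0 ≤ (s • (1 : Matrix (Fin n) (Fin n) ℝ) - A)⁻¹ i j) :
    ∀ i j, 0 < (s • (1 : Matrix (Fin n) (Fin n) ℝ) - A)⁻¹ i j := by
  intro i j
  refine aux_pos A hMetzler hIrr s (fun i => (s • (1 : Matrix (Fin n) (Fin n) ℝ) - A)⁻¹ i j)
    (fun i => (1 : Matrix (Fin n) (Fin n) ℝ) i j) (fun i => hnn i j) (fun i => aux_one i j)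
    ?_ (aux_eq A s hu j) i
  intro h0
  have h := aux_eq A s hu j j
  have h0' : ∀ i, (s • (1 : Matrix (Fin n) (Fin n) ℝ) - A)⁻¹ i j = 0 := fun i => congrFun h0 i
  simp [h0'] at h

lemma aux_main {n : ℕ} (A : Matrix (Fin n) (Fin n) ℝ)
    (hMetzler : ∀ i j, i ≠ j → 0 ≤ A i j)
    (hIrr : StronglyConnected A) (hHur : Hurwitz A) (s₀ : ℝ) (hs₀ : 0 ≤ s₀) (i₀ j₀ : Fin n) :
    0 < ((s₀ • (1 : Matrix (Fin n) (Fin n) ℝ) - A)⁻¹) i₀ j₀ := by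
  have hne : (Finset.univ : Finset (Fin n × Fin n)).Nonempty := ⟨(i₀, j₀), Finset.mem_univ _⟩
  obtain ⟨S, hS0, hS⟩ : ∃ S, s₀ ≤ S ∧ ∀ i, ∑ k, A i k < S := by
    refine ⟨s₀ + ∑ i, |∑ k, A i k| + 1, ?_, ?_⟩
    · have : 0 ≤ ∑ i, |∑ k, A i k| := Finset.sum_nonneg (fun _ _ => abs_nonneg _)
      linarith
    · intro i
      have := Finset.single_le_sum (f := fun i => |∑ k, A i k|)
        (fun _ _ => abs_nonneg _) (Finset.mem_univ i)
      have h2 := le_abs_self (∑ k, A i k)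

      linarith
  let N : ℝ → Matrix (Fin n) (Fin n) ℝ := fun s => (s • (1 : Matrix (Fin n) (Fin n) ℝ) - A)⁻¹
  let f : ℝ → ℝ := fun s => Finset.univ.inf' hne (fun p : Fin n × Fin n => N s p.1 p.2)
  have hM : Continuous (fun s : ℝ => s • (1 : Matrix (Fin n) (Fin n) ℝ) - A) := by fun_prop
  have hf : ContinuousOn f (Set.Icc s₀ S) := by
    apply ContinuousOn.finset_inf'_apply
    intro p _
    simp only [N, Matrix.inv_def, Ring.inverse_eq_inv', Matrix.smul_apply, smul_eq_mul]
    apply ContinuousOn.mul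
    · apply ContinuousOn.inv₀
      · exact hM.matrix_det.continuousOn
      · intro s hs
        exact ((Matrix.isUnit_iff_isUnit_det _).1
          (aux_unit A hHur s (hs₀.trans hs.1))).ne_zero
    · exact (hM.matrix_adjugate.matrix_elem p.1 p.2).continuousOn
  have key : ∀ s, s₀ ≤ s → 0 ≤ f s → 0 < f s := by
    intro s hs h0
    have h1 : ∀ i j, 0 ≤ N s i j := fun i j =>
      h0.trans (Finset.inf'_le _ (Finset.mem_univ (i, j)))
    have h2 := aux_strict A hMetzler hIrr s (aux_unit A hHur s (hs₀.trans hs)) h1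
    exact (Finset.lt_inf'_iff _).2 (fun p _ => h2 p.1 p.2)
  have hfS : 0 ≤ f S := by
    refine Finset.le_inf' _ _ (fun p _ => ?_)
    exact aux_large A hMetzler S hS (fun i => N S i p.2)
      (fun i => (1 : Matrix (Fin n) (Fin n) ℝ) i p.2) (fun i => aux_one i p.2)
      (aux_eq A S (aux_unit A hHur S (hs₀.trans hS0)) p.2) p.1
  have hf0 : 0 < f s₀ := by
    by_contra hneg
    obtain ⟨s, hs, hs'⟩ := intermediate_value_Icc hS0 hf ⟨not_lt.1 hneg, hfS⟩
    have := key s hs.1 hs'.ge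
    linarith
  exact hf0.trans_le (Finset.inf'_le _ (Finset.mem_univ (i₀, j₀)))

/-- For an irreducible, Hurwitz stable Metzler matrix `A`: for every `s₀ ≥ 0` the matrix
`s₀ I − A` is invertible with entrywise strictly positive inverse; consequently for the
positive system `ẋ = Ax + eᵢ d`, `y = eⱼᵀ x`, every Rosenbrock matrix
`[[s₀I − A, eᵢ],[eⱼᵀ, 0]]` has full rank `n + 1`, i.e. a single sensor at any coordinate
`eⱼ` prevents every zero-dynamics attack `d(t) = −e^{s₀ t} d₀` through any `eᵢ`. -/
theorem stmt9 {n : ℕ} (A : Matrix (Fin n) (Fin n) ℝ)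
    (hMetzler : ∀ i j, i ≠ j → 0 ≤ A i j)
    (hIrr : StronglyConnected A) (hHur : Hurwitz A) :
    ∀ s₀ : ℝ, 0 ≤ s₀ →
      IsUnit (s₀ • (1 : Matrix (Fin n) (Fin n) ℝ) - A) ∧
      (∀ i j, 0 < ((s₀ • (1 : Matrix (Fin n) (Fin n) ℝ) - A)⁻¹) i j) ∧
      (∀ i j : Fin n,
        (Matrix.fromBlocks (s₀ • (1 : Matrix (Fin n) (Fin n) ℝ) - A)
            (Matrix.of fun (k : Fin n) (_ : Fin 1) => (Pi.single i 1 : Fin n → ℝ) k)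
            (Matrix.of fun (_ : Fin 1) (k : Fin n) => (Pi.single j 1 : Fin n → ℝ) k)
            (0 : Matrix (Fin 1) (Fin 1) ℝ)).rank = n + 1) := by
  intro s₀ hs₀
  have hu := aux_unit A hHur s₀ hs₀
  refine ⟨hu, aux_main A hMetzler hIrr hHur s₀ hs₀, ?_⟩
  intro i j
  have hpos := aux_main A hMetzler hIrr hHur s₀ hs₀ j i
  generalize s₀ • (1 : Matrix (Fin n) (Fin n) ℝ) - A = M at hu hpos
  haveI := hu.invertible
  rw [Matrix.rank_of_isUnit]
  · simp
  · rw [Matrix.isUnit_fromBlocks_iff_of_invertible₁₁, Matrix.isUnit_iff_isUnit_det,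
      isUnit_iff_ne_zero, Matrix.det_fin_one, Matrix.invOf_eq_nonsing_inv]
    simp [Matrix.mul_apply, Pi.single_apply]
    exact hpos.ne'
end

section
/- Let n ≥ 2 and let L₊ⁿ = {x ∈ ℝⁿ : x₁ ≥ √(x₂² + ⋯ + xₙ²)} be the Lorentz cone, which is a self-dual proper cone with e₁ ∈ int L₊ⁿ. Let A ∈ ℝ^{n×n} be Hurwitz stable and cross-positive over L₊ⁿ. Then for every s₀ ≥ 0 the matrix s₀I − A is invertible and e₁ᵀ(s₀I − A)^{-1}e₁ > 0; hence for the Lorentz cone-invariant system with actuator b = e₁, placing one sensor c = e₁ prevents every zero-dynamics attack d(t) = −e^{s₀t}d₀. -/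
open Matrix

/-- The Lorentz cone `{x : x₁ ≥ √(x₂² + ⋯ + xₙ²)}` in dimension `n + 2 ≥ 2`. -/
def LorentzCone (n : ℕ) : Set (Fin (n + 2) → ℝ) :=
  {x | Real.sqrt (∑ i ∈ Finset.univ.filter (fun i : Fin (n + 2) => i ≠ 0), x i ^ 2) ≤ x 0}


namespace LC

/-- Euclidean norm of the spatial part. -/
noncomputable def r {n : ℕ} (x : Fin (n + 2) → ℝ) : ℝ := Real.sqrt (∑ i : Fin (n + 1), x i.succ ^ 2)

lemma sum_eq {n : ℕ} (x : Fin (n + 2) → ℝ) :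
    ∑ i ∈ Finset.univ.filter (fun i : Fin (n + 2) => i ≠ 0), x i ^ 2
      = ∑ i : Fin (n + 1), x i.succ ^ 2 := by
  rw [Finset.sum_filter, Fin.sum_univ_succ]
  simp [Fin.succ_ne_zero]

lemma mem_iff {n : ℕ} (x : Fin (n + 2) → ℝ) : x ∈ LorentzCone n ↔ r x ≤ x 0 := by
  show Real.sqrt _ ≤ _ ↔ _
  rw [sum_eq, r]

lemma r_nonneg {n : ℕ} (x : Fin (n + 2) → ℝ) : 0 ≤ r x := Real.sqrt_nonneg _

lemma r_sq {n : ℕ} (x : Fin (n + 2) → ℝ) : r x ^ 2 = ∑ i : Fin (n + 1), x i.succ ^ 2 :=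
  Real.sq_sqrt (Finset.sum_nonneg fun i _ => sq_nonneg _)

lemma dot_eq {n : ℕ} (x y : Fin (n + 2) → ℝ) :
    y ⬝ᵥ x = y 0 * x 0 + ∑ i : Fin (n + 1), y i.succ * x i.succ := by
  rw [dotProduct, Fin.sum_univ_succ]

/-- Reflection of the spatial part. -/
def refl {n : ℕ} (a : ℝ) (x : Fin (n + 2) → ℝ) : Fin (n + 2) → ℝ :=
  Fin.cons a (fun i => - x i.succ)

lemma r_refl {n : ℕ} (a : ℝ) (x : Fin (n + 2) → ℝ) : r (refl a x) = r x := by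
  simp [r, refl]

lemma dot_refl {n : ℕ} (a : ℝ) (x : Fin (n + 2) → ℝ) :
    refl a x ⬝ᵥ x = a * x 0 - r x ^ 2 := by
  rw [dot_eq, r_sq]
  simp [refl, ← pow_two, sub_eq_add_neg]

lemma r_single {n : ℕ} : r (Pi.single 0 1 : Fin (n + 2) → ℝ) = 0 := by
  simp [r, Fin.succ_ne_zero]

lemma r_cont {n : ℕ} : Continuous (r (n := n)) := by
  unfold r
  fun_prop

lemma dual_eq (n : ℕ) : dualCone (LorentzCone n) = LorentzCone n := by
  ext y
  constructor
  · intro h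
    rw [mem_iff]
    have h1 := h (Pi.single 0 1) (by rw [mem_iff, r_single]; simp)
    have h2 := h (refl (r y) y) (by rw [mem_iff, r_refl]; simp [refl])
    rw [dotProduct_comm, dot_refl] at h2
    simp at h1
    rcases (r_nonneg y).eq_or_lt with h0 | h0
    · rw [← h0]; exact h1
    · nlinarith
  · intro hy x hx
    rw [mem_iff] at hx hy
    rw [dot_eq]
    have hc := Real.sum_mul_le_sqrt_mul_sqrt Finset.univ
      (fun i : Fin (n + 1) => - y i.succ) (fun i => x i.succ)
    have hc' : -∑ i : Fin (n + 1), y i.succ * x i.succ ≤ r y * r x := by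
      simpa [r] using hc
    have := mul_le_mul hy hx (r_nonneg x) ((r_nonneg y).trans hy)
    linarith

lemma e_int (n : ℕ) : (Pi.single 0 1 : Fin (n + 2) → ℝ) ∈ interior (LorentzCone n) := by
  rw [mem_interior]
  refine ⟨{x | r x < x 0}, fun x hx => (mem_iff x).2 (le_of_lt hx),
    isOpen_lt r_cont (continuous_apply 0), ?_⟩
  simp [r_single]

lemma eq_zero {n : ℕ} (x : Fin (n + 2) → ℝ) (h : r x ≤ x 0) (h0 : x 0 ≤ 0) : x = 0 := by
  have hr : r x = 0 := le_antisymm (h.trans h0) (r_nonneg x)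
  have hs := r_sq x
  rw [hr] at hs
  have hs' : ∑ i : Fin (n + 1), x i.succ ^ 2 = 0 := by rw [← hs]; norm_num
  rw [Finset.sum_eq_zero_iff_of_nonneg (fun i _ => sq_nonneg _)] at hs'
  funext i
  refine Fin.cases ?_ (fun j => ?_) i
  · exact le_antisymm h0 ((r_nonneg x).trans h)
  · simpa using hs' j (Finset.mem_univ _)

lemma proper (n : ℕ) : IsProperCone (LorentzCone n) := by
  refine ⟨?_, ?_, ?_, ?_, ⟨_, e_int n⟩⟩
  · have : LorentzCone n = {x | r x ≤ x 0} := by ext x; exact mem_iff x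
    rw [this]
    exact isClosed_le r_cont (continuous_apply 0)
  · intro x hx y hy
    rw [← dual_eq] at hx hy ⊢
    intro z hz
    rw [add_dotProduct]
    exact add_nonneg (hx z hz) (hy z hz)
  · intro a ha x hx
    rw [← dual_eq] at hx ⊢
    intro z hz
    rw [smul_dotProduct]
    exact mul_nonneg ha (hx z hz)
  · intro x hx hy
    rw [mem_iff] at hx hy
    refine eq_zero x hx ?_
    have := (r_nonneg _).trans hy
    simpa using this

lemma hurwitz_no_real {n : ℕ} {A : Matrix (Fin n) (Fin n) ℝ} (h : Hurwitz A) (m : ℝ) (hm : 0 ≤ m)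
    (v : Fin n → ℝ) (hv : A.mulVec v = m • v) : v = 0 := by
  by_contra hne
  have := h (m : ℂ) ⟨fun i => (v i : ℂ), ?_, ?_⟩
  · simp at this; linarith
  · intro h0
    apply hne
    funext i
    simpa using congrFun h0 i
  · funext i
    have := congrArg (Complex.ofReal) (congrFun hv i)
    simpa [mulVec, dotProduct] using this

/-- Homotopy from the identity to `s I - A`. -/
def H {n : ℕ} (A : Matrix (Fin n) (Fin n) ℝ) (s t : ℝ) : Matrix (Fin n) (Fin n) ℝ :=
  (1 - t + t * s) • 1 - t • A

lemma H_det {n : ℕ} {A : Matrix (Fin n) (Fin n) ℝ} (h : Hurwitz A) (s : ℝ) (hs : 0 ≤ s)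
    (t : ℝ) (ht : t ∈ Set.Icc (0 : ℝ) 1) : (H A s t).det ≠ 0 := by
  intro h0
  obtain ⟨v, hv, hv0⟩ := Matrix.exists_mulVec_eq_zero_iff.2 h0
  apply hv
  rw [H, sub_mulVec, smul_mulVec, smul_mulVec, one_mulVec, sub_eq_zero] at hv0
  rcases ht.1.eq_or_lt with h1 | h1
  · subst h1
    simpa using hv0
  · refine hurwitz_no_real h ((1 - t + t * s) / t) ?_ v ?_
    · have := ht.2
      have := mul_nonneg h1.le hs
      apply div_nonneg _ h1.le
      linarith
    · rw [div_eq_inv_mul, mul_smul, hv0, smul_smul, inv_mul_cancel₀ h1.ne', one_smul]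

lemma key {n : ℕ} {A : Matrix (Fin (n + 2)) (Fin (n + 2)) ℝ}
    (hHur : Hurwitz A) (hCross : CrossPositive (LorentzCone n) A) (s : ℝ) (hs : 0 ≤ s) :
    0 < ((H A s 1)⁻¹.mulVec (Pi.single 0 1)) 0 := by
  set x : ℝ → Fin (n + 2) → ℝ := fun t => (H A s t)⁻¹.mulVec (Pi.single 0 1) with hx
  have hMx : ∀ t ∈ Set.Icc (0 : ℝ) 1, (H A s t).mulVec (x t) = Pi.single 0 1 := by
    intro t ht
    have hu : IsUnit (H A s t).det := (H_det hHur s hs t ht).isUnit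
    simp only [hx, mulVec_mulVec]
    rw [mul_nonsing_inv _ hu, one_mulVec]
  have hHc : Continuous (H A s) := by unfold H; fun_prop
  have hxc : ContinuousOn x (Set.Icc 0 1) := by
    have : x = fun t => ((H A s t).det)⁻¹ • ((H A s t).adjugate.mulVec (Pi.single 0 1)) := by
      funext t
      simp only [hx, inv_def, Ring.inverse_eq_inv', smul_mulVec]
    rw [this]
    refine ContinuousOn.smul (f := fun t => ((H A s t).det)⁻¹)
      (g := fun t => (H A s t).adjugate.mulVec (Pi.single 0 1)) ?_ ?_
    · exact (hHc.matrix_det.continuousOn).inv₀ (fun t ht => H_det hHur s hs t ht)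
    · exact (hHc.matrix_adjugate.matrix_mulVec continuous_const).continuousOn
  have hne : ∀ t ∈ Set.Icc (0 : ℝ) 1, x t 0 - r (x t) ≠ 0 := by
    intro t ht h0
    have hr : r (x t) = x t 0 := by linarith
    have hy : refl (x t 0) (x t) ∈ dualCone (LorentzCone n) := by
      rw [dual_eq, mem_iff, r_refl, hr]; simp [refl]
    have hc := hCross (x t) ((mem_iff _).2 hr.le) _ hy (by rw [dot_refl, hr]; ring)
    have hM := congrArg (fun z => refl (x t 0) (x t) ⬝ᵥ z) (hMx t ht)
    simp only [H, sub_mulVec, smul_mulVec, one_mulVec, dotProduct_sub, dotProduct_smul] at hM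
    rw [dot_refl, hr] at hM
    simp [refl] at hM
    have h1 := mul_nonneg ht.1 hc
    simp only [refl] at h1
    have hz : x t = 0 := by
      refine eq_zero _ hr.le ?_
      nlinarith
    have := congrFun (hMx t ht) 0
    rw [hz] at this
    simp at this
  have hx0 : x 0 = Pi.single 0 1 := by
    have : H A s 0 = 1 := by simp [H]
    simp only [hx]
    rw [this, inv_one, one_mulVec]
  have hfc : ContinuousOn (fun t => x t 0 - r (x t)) (Set.Icc 0 1) :=
    ((continuous_apply 0).comp_continuousOn hxc).sub (r_cont.comp_continuousOn hxc)
  by_contra hcon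
  have hx1 : x 1 0 ≤ 0 := not_lt.1 hcon
  have := intermediate_value_Icc' zero_le_one hfc
  obtain ⟨t, ht, ht0⟩ := this (show (0 : ℝ) ∈ _ from
    ⟨by have := r_nonneg (x 1); linarith, by simp [hx0, r_single]⟩)
  exact hne t ht ht0

end LC

/-- The Lorentz cone (dimension `≥ 2`) is a self-dual proper cone with `e₁` in its
interior, and for any `A` Hurwitz stable and cross-positive over it: for every `s₀ ≥ 0`
the matrix `s₀ I − A` is invertible, `e₁ᵀ (s₀ I − A)⁻¹ e₁ > 0`, and the Rosenbrock
matrix with actuator `b = e₁` and sensor `c = e₁` has full rank — so one sensor at `e₁`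
prevents every zero-dynamics attack `d(t) = −e^{s₀ t} d₀`. -/
theorem stmt10 {n : ℕ} (A : Matrix (Fin (n + 2)) (Fin (n + 2)) ℝ)
    (hHur : Hurwitz A) (hCross : CrossPositive (LorentzCone n) A) :
    dualCone (LorentzCone n) = LorentzCone n ∧
    IsProperCone (LorentzCone n) ∧
    (Pi.single 0 1 : Fin (n + 2) → ℝ) ∈ interior (LorentzCone n) ∧
    ∀ s₀ : ℝ, 0 ≤ s₀ →
      IsUnit (s₀ • (1 : Matrix (Fin (n + 2)) (Fin (n + 2)) ℝ) - A) ∧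
      0 < (Pi.single 0 1 : Fin (n + 2) → ℝ) ⬝ᵥ
          ((s₀ • (1 : Matrix (Fin (n + 2)) (Fin (n + 2)) ℝ) - A)⁻¹).mulVec
            (Pi.single 0 1 : Fin (n + 2) → ℝ) ∧
      (Matrix.fromBlocks (s₀ • (1 : Matrix (Fin (n + 2)) (Fin (n + 2)) ℝ) - A)
          (Matrix.of fun (k : Fin (n + 2)) (_ : Fin 1) => (Pi.single 0 1 : Fin (n + 2) → ℝ) k)
          (Matrix.of fun (_ : Fin 1) (k : Fin (n + 2)) => (Pi.single 0 1 : Fin (n + 2) → ℝ) k)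
          (0 : Matrix (Fin 1) (Fin 1) ℝ)).rank = (n + 2) + 1 := by
  refine ⟨LC.dual_eq n, LC.proper n, LC.e_int n, fun s₀ hs => ?_⟩
  have hH : s₀ • (1 : Matrix (Fin (n + 2)) (Fin (n + 2)) ℝ) - A = LC.H A s₀ 1 := by
    simp [LC.H]
  rw [hH]
  have hdet := LC.H_det hHur s₀ hs 1 (by simp)
  have hk := LC.key hHur hCross s₀ hs
  have hu : IsUnit (LC.H A s₀ 1) := (isUnit_iff_isUnit_det _).2 hdet.isUnit
  refine ⟨hu, by simpa using hk, ?_⟩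
  rw [rank_of_isUnit]
  · simp
  · rw [isUnit_iff_isUnit_det]
    letI := hu.invertible
    rw [det_fromBlocks₁₁]
    refine IsUnit.mul hdet.isUnit ?_
    rw [isUnit_iff_ne_zero, det_fin_one, invOf_eq_nonsing_inv]
    have : ∀ B : Matrix (Fin (n + 2)) (Fin (n + 2)) ℝ,
        (((0 : Matrix (Fin 1) (Fin 1) ℝ) -
          (Matrix.of fun (_ : Fin 1) (k : Fin (n + 2)) => (Pi.single 0 1 : Fin (n + 2) → ℝ) k) * B *
          (Matrix.of fun (k : Fin (n + 2)) (_ : Fin 1) => (Pi.single 0 1 : Fin (n + 2) → ℝ) k)) 0 0)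
          = - (B.mulVec (Pi.single 0 1) 0) := by
      intro B
      simp [Matrix.mul_apply, Pi.single_apply]
    rw [this]
    exact (neg_lt_zero.2 hk).ne
end
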